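/- Let k be a field of characteristic zero, K = k(t), and let γ, c ∈ k[t] with φ(x) = (x−γ)² + c. Assume φ is stable, post-critically infinite, and h(γ) ≠ h(c). Then for every n ≥ 1, 2^(2^n − 1) ≤ 2^(65519) · [K_n : K], where [K_n : K] is the degree of the splitting field of φ^n over K; that is, the index of the n-th level Galois group in Aut(T_n) is at most 2^(2^16 − 17) = 2^65519, uniformly in φ. -/

import Mathlib

open Polynomial

section Arithmetic

variable {k : Type*} [Field k] [CharZero k]

/-- If `i f' g = j f g'` then comparing leading coefficients gives `i deg f = j deg g`. -/
theorem natDegree_eq_of_mul_derivative_eq {f g : k[X]} (hf : f ≠ 0) (hg : g ≠ 0) (i j : ℕ)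
    (h : (i : k[X]) * (derivative f * g) = (j : k[X]) * (f * derivative g)) :
    i * f.natDegree = j * g.natDegree := by
  have coeff_X_derivative : ∀ p : k[X], (X * derivative p).coeff p.natDegree
      = p.natDegree * p.leadingCoeff := by
    intro p
    rcases hp : p.natDegree with _ | m
    · simp
    · rw [coeff_X_mul, coeff_derivative, leadingCoeff, hp]
      push_cast
      ring
  have natDegree_X_derivative : ∀ p : k[X], (X * derivative p).natDegree ≤ p.natDegree := by
    intro p
    rcases hp : p.natDegree with _ | m
    · rw [natDegree_eq_zero] at hp
      obtain ⟨x, rfl⟩ := hp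
      simp
    · refine natDegree_mul_le.trans ?_
      have := natDegree_derivative_le p
      rw [natDegree_X]
      omega
  have h' : C (i : k) * ((X * derivative f) * g) = C (j : k) * (f * (X * derivative g)) := by
    simp only [C_eq_natCast]
    linear_combination X * h
  have h2 := congrArg (fun p => p.coeff (f.natDegree + g.natDegree)) h'
  simp only [coeff_C_mul] at h2
  rw [coeff_mul_add_eq_of_natDegree_le (natDegree_X_derivative f) le_rfl,
    coeff_mul_add_eq_of_natDegree_le le_rfl (natDegree_X_derivative g), coeff_X_derivative,
    coeff_X_derivative, coeff_natDegree, coeff_natDegree] at h2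
  have h3 : ((i * f.natDegree : ℕ) : k) = ((j * g.natDegree : ℕ) : k) := by
    have hf' := leadingCoeff_ne_zero.mpr hf
    have hg' := leadingCoeff_ne_zero.mpr hg
    apply mul_right_cancel₀ (mul_ne_zero hf' hg')
    push_cast
    linear_combination h2
  exact_mod_cast h3

/-- A polynomial of the form `((w² + α)² + α)² + c` with `deg w` large has a large
squarefree part. -/
theorem natDegree_le_of_sq_mul_eq {c α w e y : k[X]} {d : ℕ} (hc : c ≠ 0)
    (hcd : c.natDegree ≤ d) (hα : α.natDegree = d) (hd : 1 ≤ d)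
    (hw : 7 * d ≤ w.natDegree)
    (h : ((w ^ 2 + α) ^ 2 + α) ^ 2 + c = e * y ^ 2) :
    w.natDegree ≤ e.natDegree + 7 * d := by
  by_contra! hlt
  set D := w.natDegree with hD
  obtain ⟨u, hu⟩ : ∃ u, u = w ^ 2 + α := ⟨_, rfl⟩
  obtain ⟨W, hW⟩ : ∃ W, W = u ^ 2 + α := ⟨_, rfl⟩
  rw [← hu, ← hW] at h
  have sq_add : ∀ p q : k[X], q.natDegree < 2 * p.natDegree →
      (p ^ 2 + q).natDegree = 2 * p.natDegree := by
    intro p q hpq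
    rw [natDegree_add_eq_left_of_natDegree_lt] <;> rw [natDegree_pow]
    exact hpq
  have hud : u.natDegree = 2 * D := by rw [hu, sq_add]; omega
  have hWd : W.natDegree = 4 * D := by rw [hW, sq_add] <;> omega
  have hed : (W ^ 2 + c).natDegree = 8 * D := by rw [sq_add] <;> omega
  have hb : (α ^ 2 + c).natDegree = 2 * d := by rw [sq_add] <;> omega
  have ne_of : ∀ p : k[X], 0 < p.natDegree → p ≠ 0 := by
    rintro p hp rfl
    simp at hp
  have hα0 : α ≠ 0 := ne_of α (by omega)
  have hw0 : w ≠ 0 := ne_of w (by omega)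
  have hu0 : u ≠ 0 := ne_of u (by omega)
  have hW0 : W ≠ 0 := ne_of W (by omega)
  have hb0 : α ^ 2 + c ≠ 0 := ne_of _ (by omega)
  have hey : e * y ^ 2 ≠ 0 := by rw [← h]; exact ne_of _ (by omega)
  have he0 : e ≠ 0 := left_ne_zero_of_mul hey
  have hy0 : y ≠ 0 := by
    rintro rfl
    simp at hey
  have heyd : e.natDegree + 2 * y.natDegree = 8 * D := by
    rw [← hed, h, natDegree_mul he0 (pow_ne_zero _ hy0), natDegree_pow]
  have hder : ∀ p : k[X], (derivative p).natDegree ≤ p.natDegree := fun p =>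
    (natDegree_derivative_le p).trans (Nat.sub_le _ _)
  have hc' := hder c
  have hα' := hder α
  have hw' := hder w
  have hW' := hder W
  -- `y` divides `c T`
  set T := derivative c * W - 2 * c * derivative W with hT
  have hdh := congrArg derivative h
  simp only [derivative_add, derivative_pow, derivative_mul, Nat.cast_ofNat, map_ofNat,
    Nat.add_one_sub_one, pow_one] at hdh
  obtain ⟨q, hq⟩ : ∃ q, c * T = y * q := by
    refine ⟨e * y * T - W * (derivative c * e * y - c * (derivative e * y + 2 * e * derivative y)), ?_⟩
    have h1 : W * T = y * (derivative c * e * y - c * (derivative e * y + 2 * e * derivative y)) := by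
      rw [hT]
      linear_combination derivative c * h - c * hdh
    linear_combination T * h - W * h1
  have two_d : (2 : k[X]).natDegree = 0 := natDegree_ofNat 2
  have hTd : T.natDegree ≤ d + 4 * D := by
    refine (natDegree_sub_le _ _).trans (max_le ?_ ?_)
    · exact natDegree_mul_le.trans (by omega)
    · refine natDegree_mul_le.trans ?_
      have := natDegree_mul_le (p := (2 : k[X])) (q := c)
      omega
  have hT0 : T ≠ 0 := by
    intro h0
    have := natDegree_eq_of_mul_derivative_eq hc hW0 1 2 (by
      push_cast
      linear_combination h0)
    omega
  have hq0 : q ≠ 0 := by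
    rintro rfl
    exact mul_ne_zero hc hT0 (by rw [hq, mul_zero])
  have hqd : 2 * q.natDegree ≤ 4 * d + e.natDegree := by
    have h1 := congrArg natDegree hq
    rw [natDegree_mul hc hT0, natDegree_mul hy0 hq0] at h1
    omega
  obtain ⟨v, hv⟩ : ∃ v, v = derivative c * u - 4 * c * derivative u := ⟨_, rfl⟩
  obtain ⟨s, hs⟩ : ∃ s, s = derivative c * α - 2 * c * derivative α := ⟨_, rfl⟩
  have hTv : T = u * v + s := by
    rw [hT, hW, hv, hs]
    simp only [derivative_add, derivative_pow, Nat.cast_ofNat, map_ofNat,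
      Nat.add_one_sub_one, pow_one]
    ring
  have hsd : s.natDegree ≤ 2 * d := by
    rw [hs]
    refine (natDegree_sub_le _ _).trans (max_le ?_ ?_)
    · exact natDegree_mul_le.trans (by omega)
    · refine natDegree_mul_le.trans ?_
      have := natDegree_mul_le (p := (2 : k[X])) (q := c)
      omega
  have hmain : e * (c * (u * v + s)) ^ 2 = q ^ 2 * ((u ^ 2 + α) ^ 2 + c) := by
    rw [← hTv, hq, ← hW, h]
    ring
  -- reduction modulo `u`
  have hz : e * c ^ 2 * s ^ 2 - q ^ 2 * (α ^ 2 + c) = 0 := by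
    apply eq_zero_of_dvd_of_natDegree_lt (p := u)
    · refine ⟨q ^ 2 * (u ^ 3 + 2 * α * u) - e * c ^ 2 * (u * v ^ 2 + 2 * v * s), ?_⟩
      linear_combination hmain
    · refine lt_of_le_of_lt ((natDegree_sub_le _ _).trans (max_le ?_ ?_))
        (show e.natDegree + 6 * d < u.natDegree by omega)
      · have h1 := natDegree_mul_le (p := e * c ^ 2) (q := s ^ 2)
        have h2 := natDegree_mul_le (p := e) (q := c ^ 2)
        rw [natDegree_pow] at h1 h2
        omega
      · have h1 := natDegree_mul_le (p := q ^ 2) (q := α ^ 2 + c)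
        rw [natDegree_pow] at h1
        omega
  have hs0 : s ≠ 0 := by
    rintro rfl
    have : q ^ 2 * (α ^ 2 + c) = 0 := by linear_combination -hz
    exact mul_ne_zero (pow_ne_zero 2 hq0) hb0 this
  have hdvd : u ∣ 8 * (e * c ^ 3 * s * α * (2 * α * derivative w - derivative α * w)) := by
    have h1 : e * c ^ 2 * (u * v ^ 2 + 2 * v * s) = q ^ 2 * (u ^ 3 + 2 * α * u) := by
      apply mul_left_cancel₀ hu0
      linear_combination hmain - hz
    have h2 : 8 * (e * c ^ 3 * s * derivative u) = u * (e * c ^ 2 * v ^ 2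
        + 2 * e * c ^ 2 * s * derivative c - q ^ 2 * (u ^ 2 + 2 * α)) := by
      rw [hv] at h1 ⊢
      linear_combination -h1
    have h3 : α * derivative u - derivative α * u
        = w * (2 * α * derivative w - derivative α * w) := by
      rw [hu]
      simp only [derivative_add, derivative_pow, Nat.cast_ofNat, map_ofNat,
        Nat.add_one_sub_one, pow_one]
      ring
    refine ⟨8 * (e * c ^ 3 * s * (2 * α * derivative w - derivative α * w))
      - w * α * (e * c ^ 2 * v ^ 2 + 2 * e * c ^ 2 * s * derivative c - q ^ 2 * (u ^ 2 + 2 * α))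
      + w * (8 * (e * c ^ 3 * s)) * derivative α, ?_⟩
    linear_combination (-8 * (e * c ^ 3 * s * (2 * α * derivative w - derivative α * w))) * hu
      - (w * α) * h2 + (8 * w * (e * c ^ 3 * s)) * h3
  have hz2 : 8 * (e * c ^ 3 * s * α * (2 * α * derivative w - derivative α * w)) = 0 := by
    apply eq_zero_of_dvd_of_natDegree_lt hdvd
    have h8 : (8 : k[X]).natDegree = 0 := natDegree_ofNat 8
    have h0 := natDegree_mul_le (p := (8 : k[X]))
      (q := e * c ^ 3 * s * α * (2 * α * derivative w - derivative α * w))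
    have h1 := natDegree_mul_le (p := e * c ^ 3 * s * α)
      (q := 2 * α * derivative w - derivative α * w)
    have h2 := natDegree_mul_le (p := e * c ^ 3 * s) (q := α)
    have h3 := natDegree_mul_le (p := e * c ^ 3) (q := s)
    have h4 := natDegree_mul_le (p := e) (q := c ^ 3)
    rw [natDegree_pow] at h4
    have h5 : (2 * α * derivative w - derivative α * w).natDegree ≤ d + D := by
      refine (natDegree_sub_le _ _).trans (max_le ?_ ?_)
      · refine natDegree_mul_le.trans ?_
        have := natDegree_mul_le (p := (2 : k[X])) (q := α)
        omega
      · exact natDegree_mul_le.trans (by omega)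
    omega
  have h8 : (8 : k[X]) ≠ 0 := by norm_num
  have hz3 : 2 * α * derivative w - derivative α * w = 0 := by
    simpa [h8, he0, hc, hs0, hα0] using hz2
  have := natDegree_eq_of_mul_derivative_eq hα0 hw0 1 2 (by
    push_cast
    linear_combination -hz3)
  omega

end Arithmetic

section Orbit

/-- The quadratic map `x ↦ (x - γ)² + c`. -/
def quad {R : Type*} [CommRing R] (γ c x : R) : R := (x - γ) ^ 2 + c

theorem map_quad_iterate {R S : Type*} [CommRing R] [CommRing S] (σ : R →+* S) (γ c x : R)
    (n : ℕ) : σ ((quad γ c)^[n] x) = (quad (σ γ) (σ c))^[n] (σ x) :=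
  Function.Semiconj.iterate_right (f := σ) (fun x => by simp [quad]) n x

variable {k : Type*} [Field k]

theorem natDegree_quad_le {γ c x : k[X]} {d N : ℕ} (hγ : γ.natDegree ≤ d)
    (hc : c.natDegree ≤ d) (hx : x.natDegree ≤ N) (hN : d ≤ N) :
    (quad γ c x).natDegree ≤ 2 * N := by
  refine (natDegree_add_le _ _).trans (max_le ?_ (by omega))
  rw [natDegree_pow]
  have := (natDegree_sub_le x γ).trans (max_le hx (hγ.trans hN))
  omega

theorem natDegree_quad_iterate_le {γ c x : k[X]} {d : ℕ} (hγ : γ.natDegree ≤ d)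
    (hc : c.natDegree ≤ d) (hx : x.natDegree ≤ d) (n : ℕ) :
    ((quad γ c)^[n] x).natDegree ≤ 2 ^ n * d := by
  induction n with
  | zero => simpa using hx
  | succ n ih =>
    rw [Function.iterate_succ_apply', pow_succ', mul_assoc]
    exact natDegree_quad_le hγ hc ih (Nat.le_mul_of_pos_left _ (by positivity))

theorem natDegree_quad_iterate_sub {γ c : k[X]} {d : ℕ} (hα : (c - γ).natDegree = d)
    (hd : 1 ≤ d) (n : ℕ) :
    ((quad γ c)^[n + 1] γ - γ).natDegree = 2 ^ n * d := by
  induction n with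
  | zero => simpa [quad] using hα
  | succ n ih =>
    rw [Function.iterate_succ_apply', quad, add_sub_assoc, natDegree_add_eq_left_of_natDegree_lt]
    · rw [natDegree_pow, ih]
      ring
    · rw [natDegree_pow, ih, hα]
      have : 1 ≤ 2 ^ n := Nat.one_le_two_pow
      nlinarith

theorem exists_squarefree_mul_sq {f : k[X]} (hf : f ≠ 0) :
    ∃ e y : k[X], Squarefree e ∧ f = e * y ^ 2 := by
  induction hn : f.natDegree using Nat.strong_induction_on generalizing f with
  | _ n ih =>
    by_cases hsq : Squarefree f
    · exact ⟨f, 1, hsq, by simp⟩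
    · rw [Squarefree] at hsq
      push Not at hsq
      obtain ⟨x, ⟨g, rfl⟩, hx⟩ := hsq
      have hx0 : x ≠ 0 := by
        rintro rfl
        simp at hf
      have hg0 : g ≠ 0 := right_ne_zero_of_mul hf
      have hxd : 0 < x.natDegree := by
        rw [Nat.pos_iff_ne_zero]
        exact fun h => hx ((isUnit_iff_degree_eq_zero).mpr (by
          rw [degree_eq_natDegree hx0, h]; rfl))
      obtain ⟨e, y, he, rfl⟩ := ih g.natDegree (by
        rw [← hn, natDegree_mul (mul_ne_zero hx0 hx0) hg0, natDegree_mul hx0 hx0]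
        omega) hg0 rfl
      exact ⟨e, y * x, he, by ring⟩

theorem sum_two_pow_le (h : ℕ) : ∑ m ∈ Finset.Icc 1 h, 2 ^ m ≤ 2 * 2 ^ h := by
  induction h with
  | zero => simp
  | succ h ih =>
    rw [Finset.sum_Icc_succ_top (by omega), pow_succ]
    omega

theorem sub_natDegree_of_ne {γ c : k[X]} (h : γ.natDegree ≠ c.natDegree) :
    (c - γ).natDegree = max γ.natDegree c.natDegree := by
  rcases lt_or_gt_of_ne h with h | h
  · rw [natDegree_sub_eq_left_of_natDegree_lt h, max_eq_right h.le]
  · rw [natDegree_sub_eq_right_of_natDegree_lt h, max_eq_left h.le]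

/-- For `n ≥ 17` the `n`-th point of the critical orbit has a zero of odd order which is not a
zero of an earlier point of the orbit. -/
theorem exists_primitive_zero [CharZero k] {γ c : k[X]} (hdeg : γ.natDegree ≠ c.natDegree)
    (hc : c ≠ 0) (hcrit : ∀ n, 1 ≤ n → (quad γ c)^[n] γ ≠ 0)
    (hzero : ∀ n, 1 ≤ n → (quad γ c)^[n] 0 ≠ 0) {n : ℕ} (hn : 17 ≤ n) :
    ∃ (τ : AlgebraicClosure k) (e y : k[X]), (quad γ c)^[n] γ = e * y ^ 2 ∧ e.Separable ∧
      aeval τ e = 0 ∧ ∀ m, 1 ≤ m → m < n → aeval τ ((quad γ c)^[m] γ) ≠ 0 := by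
  obtain ⟨e, y, he, hey⟩ := exists_squarefree_mul_sq (hcrit n (by omega))
  have hsep : e.Separable := PerfectField.separable_iff_squarefree.mpr he
  by_contra! hcon
  set d := max γ.natDegree c.natDegree with hd
  have hγd : γ.natDegree ≤ d := le_max_left _ _
  have hcd : c.natDegree ≤ d := le_max_right _ _
  have hd1 : 1 ≤ d := by
    rcases lt_or_gt_of_ne hdeg with h | h <;> omega
  have hα := sub_natDegree_of_ne hdeg
  rw [← hd] at hα
  set h := n / 2 with hh
  set P : k[X] := (∏ m ∈ Finset.Icc 1 h, (quad γ c)^[m] γ) * ∏ m ∈ Finset.Icc 1 h, (quad γ c)^[m] 0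
    with hP
  have hP0 : P ≠ 0 := mul_ne_zero
    (Finset.prod_ne_zero_iff.mpr fun m hm => hcrit m (Finset.mem_Icc.mp hm).1)
    (Finset.prod_ne_zero_iff.mpr fun m hm => hzero m (Finset.mem_Icc.mp hm).1)
  have hPd : P.natDegree ≤ 4 * 2 ^ h * d := by
    have key : ∀ x : k[X], x.natDegree ≤ d →
        (∏ m ∈ Finset.Icc 1 h, (quad γ c)^[m] x).natDegree ≤ 2 * 2 ^ h * d := by
      intro x hx
      refine (natDegree_prod_le _ _).trans ?_
      refine (Finset.sum_le_sum fun m _ => natDegree_quad_iterate_le hγd hcd hx m).trans ?_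
      rw [← Finset.sum_mul]
      exact Nat.mul_le_mul_right _ (sum_two_pow_le h)
    have h1 := key γ hγd
    have h2 := key 0 (by simp)
    refine natDegree_mul_le.trans ?_
    nlinarith
  have hsub : e.rootSet (AlgebraicClosure k) ⊆ P.rootSet (AlgebraicClosure k) := by
    intro τ hτ
    rw [mem_rootSet] at hτ ⊢
    refine ⟨hP0, ?_⟩
    obtain ⟨m, hm1, hmn, hm⟩ := hcon τ e y hey hsep hτ.2
    rw [hP, map_mul, map_prod, map_prod, mul_eq_zero, Finset.prod_eq_zero_iff,
      Finset.prod_eq_zero_iff]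
    by_cases hmh : m ≤ h
    · exact Or.inl ⟨m, Finset.mem_Icc.mpr ⟨hm1, hmh⟩, hm⟩
    · refine Or.inr ⟨n - m, Finset.mem_Icc.mpr ⟨by omega, by omega⟩, ?_⟩
      have h1 : aeval τ ((quad γ c)^[n] γ) = 0 := by
        rw [hey, map_mul, hτ.2, zero_mul]
      have h2 : n = (n - m) + m := by omega
      rw [h2, Function.iterate_add_apply] at h1
      rw [← AlgHom.coe_toRingHom, map_quad_iterate] at h1 ⊢
      rw [AlgHom.coe_toRingHom, hm] at h1
      rwa [map_zero]
  have hed : e.natDegree ≤ 4 * 2 ^ h * d := by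
    rw [← card_rootSet_eq_natDegree (K := AlgebraicClosure k) hsep (IsAlgClosed.splits _)]
    rw [← Nat.card_eq_fintype_card, Nat.card_coe_set_eq]
    exact (Set.ncard_le_ncard hsub (rootSet_finite _ _)).trans
      ((ncard_rootSet_le _ _).trans hPd)
  obtain ⟨i, rfl⟩ : ∃ i, n = i + 1 + 1 + 1 + 1 := ⟨n - 4, by omega⟩
  have hw := natDegree_quad_iterate_sub hα hd1 i
  have hfin := natDegree_le_of_sq_mul_eq (w := (quad γ c)^[i + 1] γ - γ) (e := e) (y := y)
    hc hcd hα hd1 (by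
      rw [hw]
      have : 2 ^ 3 ≤ 2 ^ i := Nat.pow_le_pow_right (by norm_num) (by omega)
      nlinarith) (by
      rw [← hey]
      simp only [Function.iterate_succ_apply', quad]
      ring)
  rw [hw] at hfin
  have h1 : 2 ^ i * d ≤ (4 * 2 ^ h + 7) * d := by linarith
  have h2 := Nat.le_of_mul_le_mul_right h1 hd1
  have h3 : 2 ^ (h + 4) ≤ 2 ^ i := Nat.pow_le_pow_right (by norm_num) (by omega)
  have h4 : 2 ^ 3 ≤ 2 ^ h := Nat.pow_le_pow_right (by norm_num) (by omega)
  rw [pow_add] at h3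
  omega

end Orbit

section IteratePolynomial

variable {R : Type*} [CommRing R]

/-- The `n`-th iterate of `(X - γ)² + c` as a polynomial. -/
noncomputable def quadIter (γ c : R) (n : ℕ) : R[X] :=
  (fun p : R[X] => p.comp ((X - C γ) ^ 2 + C c))^[n] X

theorem quadIter_zero (γ c : R) : quadIter γ c 0 = X := rfl

theorem quadIter_succ (γ c : R) (n : ℕ) :
    quadIter γ c (n + 1) = (quadIter γ c n).comp ((X - C γ) ^ 2 + C c) :=
  Function.iterate_succ_apply' _ _ _

theorem quadIter_map {S : Type*} [CommRing S] (σ : R →+* S) (γ c : R) (n : ℕ) :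
    (quadIter γ c n).map σ = quadIter (σ γ) (σ c) n := by
  induction n with
  | zero => simp [quadIter_zero]
  | succ n ih => simp [quadIter_succ, Polynomial.map_comp, ih]

theorem eval_quadIter (γ c x : R) (n : ℕ) :
    (quadIter γ c n).eval x = (quad γ c)^[n] x := by
  induction n generalizing x with
  | zero => simp [quadIter_zero]
  | succ n ih =>
    rw [quadIter_succ, eval_comp, ih, Function.iterate_succ_apply]
    simp [quad]

theorem aeval_quadIter {S : Type*} [CommRing S] [Algebra R S] (γ c : R) (x : S) (n : ℕ) :
    aeval x (quadIter γ c n) = (quad (algebraMap R S γ) (algebraMap R S c))^[n] x := by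
  rw [aeval_def, ← eval_map, quadIter_map, eval_quadIter]

theorem natDegree_X_sub_C_sq_add_C [Nontrivial R] (γ c : R) :
    ((X - C γ) ^ 2 + C c).natDegree = 2 := by
  rw [natDegree_add_C, (monic_X_sub_C γ).natDegree_pow, natDegree_X_sub_C]

theorem monic_X_sub_C_sq_add_C [Nontrivial R] (γ c : R) :
    ((X - C γ) ^ 2 + C c).Monic := by
  refine ((monic_X_sub_C γ).pow 2).add_of_left (degree_C_le.trans_lt ?_)
  rw [← natDegree_pos_iff_degree_pos, (monic_X_sub_C γ).natDegree_pow, natDegree_X_sub_C]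
  norm_num

theorem monic_quadIter [IsDomain R] (γ c : R) (n : ℕ) : (quadIter γ c n).Monic := by
  induction n with
  | zero => exact monic_X
  | succ n ih =>
    rw [quadIter_succ]
    exact ih.comp (monic_X_sub_C_sq_add_C γ c) (by simp)

theorem natDegree_quadIter [IsDomain R] (γ c : R) (n : ℕ) :
    (quadIter γ c n).natDegree = 2 ^ n := by
  induction n with
  | zero => simp [quadIter_zero]
  | succ n ih => rw [quadIter_succ, natDegree_comp, ih, natDegree_X_sub_C_sq_add_C, pow_succ]

end IteratePolynomial

section PowerSeries

variable {L : Type*} [Field L]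

theorem exists_sq_eq_powerSeries [IsAlgClosed L] [CharZero L] {a : PowerSeries L}
    (ha : PowerSeries.constantCoeff a ≠ 0) : ∃ r : PowerSeries L, r ^ 2 = a := by
  obtain ⟨z, hz⟩ := IsAlgClosed.exists_pow_nat_eq (PowerSeries.constantCoeff a) (n := 2) (by norm_num)
  have hz0 : z ≠ 0 := by
    rintro rfl
    exact ha (by rw [← hz]; simp)
  obtain ⟨r, hr, -⟩ := HenselianRing.is_henselian (I := Ideal.span {(PowerSeries.X : PowerSeries L)})
    (X ^ 2 - C a) (monic_X_pow_sub_C a (by norm_num)) (PowerSeries.C z) (by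
      rw [Ideal.mem_span_singleton, PowerSeries.X_dvd_iff]
      simp [hz]) (by
      apply IsUnit.map
      rw [PowerSeries.isUnit_iff_constantCoeff]
      simp [hz0])
  refine ⟨r, ?_⟩
  simpa [sub_eq_zero] using hr

theorem not_isSquare_of_odd_order {a : PowerSeries L} {N : ℕ} (hN : Odd N)
    (ha : a.order = N) : ¬ IsSquare (algebraMap (PowerSeries L) (FractionRing (PowerSeries L))
      a) := by
  rintro ⟨z, hz⟩
  obtain ⟨p, q, hq, rfl⟩ := IsFractionRing.div_surjective (A := PowerSeries L) z
  have hq0 : q ≠ 0 := nonZeroDivisors.ne_zero hq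
  have hq' : algebraMap (PowerSeries L) (FractionRing (PowerSeries L)) q ≠ 0 := by
    simpa using hq0
  field_simp at hz
  rw [← map_pow, ← map_pow, ← map_mul] at hz
  have h1 := IsFractionRing.injective _ _ hz
  have hp0 : p ≠ 0 := by
    rintro rfl
    have ha0 : a ≠ 0 := by
      rintro rfl
      simp at ha
    simp [ha0, hq0] at h1
  have h2 := congrArg PowerSeries.order h1
  rw [PowerSeries.order_mul, PowerSeries.order_pow, PowerSeries.order_pow, ha,
    ← PowerSeries.coe_toNat_order hq0, ← PowerSeries.coe_toNat_order hp0] at h2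
  simp only [nsmul_eq_mul] at h2
  norm_cast at h2
  rw [Nat.odd_iff] at hN
  omega

variable {g κ : PowerSeries L} {m : ℕ}

theorem constantCoeff_quad_iterate_congr {x y : PowerSeries L}
    (h : PowerSeries.constantCoeff x = PowerSeries.constantCoeff y) (n : ℕ) :
    PowerSeries.constantCoeff ((quad g κ)^[n] x)
      = PowerSeries.constantCoeff ((quad g κ)^[n] y) := by
  rw [map_quad_iterate, map_quad_iterate, h]

theorem quad_self {R : Type*} [CommRing R] (γ c : R) : quad γ c γ = c := by simp [quad]

/-- Over power series with algebraically closed coefficients, an iterate with no critical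
value reducing to zero splits completely. -/
theorem exists_quadIter_eq_prod [IsAlgClosed L] [CharZero L]
    (h : ∀ j, 1 ≤ j → j ≤ m → PowerSeries.constantCoeff ((quad g κ)^[j] g) ≠ 0) :
    ∃ s : Multiset (PowerSeries L), quadIter g κ m = (s.map fun α => X - C α).prod := by
  induction m with
  | zero => exact ⟨{0}, by simp [quadIter_zero]⟩
  | succ m ih =>
    obtain ⟨s, hs⟩ := ih fun j h1 h2 => h j h1 (by omega)
    have hroot : ∀ α ∈ s, (quad g κ)^[m] α = 0 := by
      intro α hα
      rw [← eval_quadIter, hs, eval_multiset_prod, Multiset.map_map, Multiset.prod_eq_zero_iff]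
      exact Multiset.mem_map.mpr ⟨α, hα, by simp⟩
    have hsq : ∀ α ∈ s, ∃ r : PowerSeries L, r ^ 2 = α - κ := by
      intro α hα
      apply exists_sq_eq_powerSeries
      intro h0
      apply h (m + 1) (by omega) le_rfl
      rw [map_sub, sub_eq_zero] at h0
      rw [Function.iterate_succ_apply, quad_self, constantCoeff_quad_iterate_congr h0.symm,
        hroot α hα, map_zero]
    choose! r hr using hsq
    refine ⟨s.map (fun α => g + r α) + s.map (fun α => g - r α), ?_⟩
    rw [quadIter_succ, hs, multiset_prod_comp, Multiset.map_add, Multiset.prod_add,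
      Multiset.map_map, Multiset.map_map, Multiset.map_map, ← Multiset.prod_map_mul]
    refine congrArg _ (Multiset.map_congr rfl fun α hα => ?_)
    have := congrArg C (hr α hα)
    simp only [map_sub, map_pow] at this
    simp only [Function.comp_apply, sub_comp, X_comp, C_comp, map_add, map_sub]
    linear_combination this

theorem eq_of_constantCoeff_eq_of_quad_iterate_eq_zero [CharZero L]
    (h : ∀ j, 1 ≤ j → j ≤ m → PowerSeries.constantCoeff ((quad g κ)^[j] g) ≠ 0) {x y : PowerSeries L}
    (hx : (quad g κ)^[m] x = 0) (hy : (quad g κ)^[m] y = 0)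
    (hxy : PowerSeries.constantCoeff x = PowerSeries.constantCoeff y) : x = y := by
  induction m generalizing x y with
  | zero => exact Eq.trans hx (Eq.symm hy)
  | succ m ih =>
    have h1 : quad g κ x = quad g κ y := ih (fun j h1 h2 => h j h1 (by omega)) hx hy
      (by simp [quad, hxy])
    have h2 : (x - y) * (x + y - 2 * g) = 0 := by
      simp only [quad] at h1
      linear_combination h1
    rcases mul_eq_zero.mp h2 with h3 | h3
    · exact sub_eq_zero.mp h3
    · have h4 := congrArg PowerSeries.constantCoeff h3
      simp only [map_sub, map_add, map_mul, map_ofNat, map_zero, ← hxy] at h4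
      have h5 : PowerSeries.constantCoeff x = PowerSeries.constantCoeff g := by
        linear_combination h4 / 2
      refine absurd ?_ (h (m + 1) (by omega) le_rfl)
      rw [← constantCoeff_quad_iterate_congr h5, hx, map_zero]

/-- If the reduction of the critical orbit first vanishes at the index `m + 1`, to odd order, then
exactly one root of the `m`-th iterate reduces to `κ`, and it agrees with `κ` to odd order. -/
theorem exists_root_odd_order [IsAlgClosed L] [CharZero L]
    (h : ∀ j, 1 ≤ j → j ≤ m → PowerSeries.constantCoeff ((quad g κ)^[j] g) ≠ 0) {N : ℕ}
    (hN : Odd N) (hord : ((quad g κ)^[m + 1] g).order = N) :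
    ∃ x : PowerSeries L, (quad g κ)^[m] x = 0 ∧ (∃ N : ℕ, Odd N ∧ (κ - x).order = N) ∧
      ∀ y, (quad g κ)^[m] y = 0 → y ≠ x → PowerSeries.constantCoeff (κ - y) ≠ 0 := by
  obtain ⟨s, hs⟩ := exists_quadIter_eq_prod h
  have heval : ∀ z, (quad g κ)^[m] z = (s.map fun α => z - α).prod := by
    intro z
    rw [← eval_quadIter, hs, eval_multiset_prod, Multiset.map_map]
    simp
  rw [Function.iterate_succ_apply, quad_self, heval] at hord
  have hroot : ∀ α ∈ s, (quad g κ)^[m] α = 0 := by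
    intro α hα
    rw [heval, Multiset.prod_eq_zero_iff]
    exact Multiset.mem_map.mpr ⟨α, hα, sub_self α⟩
  have hcc : PowerSeries.constantCoeff (s.map fun α => κ - α).prod = 0 := by
    rw [← PowerSeries.order_ne_zero_iff_constCoeff_eq_zero, hord]
    exact_mod_cast hN.pos.ne'
  rw [map_multiset_prod, Multiset.map_map, Multiset.prod_eq_zero_iff, Multiset.mem_map] at hcc
  obtain ⟨x, hxs, hx⟩ := hcc
  simp only [Function.comp_apply] at hx
  have hother : ∀ y, (quad g κ)^[m] y = 0 → y ≠ x → PowerSeries.constantCoeff (κ - y) ≠ 0 := by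
    intro y hy hyx h0
    refine hyx (eq_of_constantCoeff_eq_of_quad_iterate_eq_zero h hy (hroot x hxs) ?_)
    rw [map_sub] at h0 hx
    linear_combination hx - h0
  have hcount : ∀ t : Multiset (PowerSeries L), t ≤ s →
      ∃ j : ℕ, (t.map fun α => κ - α).prod.order = j * (κ - x).order := by
    intro t
    induction t using Multiset.induction_on with
    | empty => exact fun _ => ⟨0, by simp⟩
    | cons a t ih =>
      intro hle
      obtain ⟨j, hj⟩ := ih ((Multiset.le_cons_self t a).trans hle)
      rw [Multiset.map_cons, Multiset.prod_cons, PowerSeries.order_mul, hj]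
      by_cases hax : a = x
      · exact ⟨j + 1, by rw [hax]; push_cast; ring⟩
      · have ha := hother a (hroot a (Multiset.mem_of_le hle (Multiset.mem_cons_self a t))) hax
        have ha0 : (κ - a).order = 0 := by
          by_contra hne
          exact ha (PowerSeries.order_ne_zero_iff_constCoeff_eq_zero.mp hne)
        exact ⟨j, by rw [ha0, zero_add]⟩
  obtain ⟨j, hj⟩ := hcount s le_rfl
  rw [hord] at hj
  refine ⟨x, hroot x hxs, ?_, hother⟩
  have hne : κ - x ≠ 0 := by
    intro h0
    rw [h0, PowerSeries.order_zero] at hj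
    rcases Nat.eq_zero_or_pos j with rfl | hjp
    · have : N = 0 := by simpa using hj
      exact hN.pos.ne' this
    · rw [ENat.mul_top (by exact_mod_cast hjp.ne')] at hj
      exact ENat.natCast_ne_top N hj
  rw [← PowerSeries.coe_toNat_order hne] at hj ⊢
  norm_cast at hj
  subst hj
  exact ⟨_, (Nat.odd_mul.mp hN).2, rfl⟩

end PowerSeries

section Multiquadratic

open IntermediateField

universe u v

/-- Adjoining square roots of elements that are independent modulo squares. -/
theorem two_pow_card_le_finrank {ι : Type v} {N : Type u} [Field N] (s : Finset ι) (r : ι → N) :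
    ∀ (M : Type u) [Field M] [CharZero M] [Algebra M N] [FiniteDimensional M N] (a : ι → M),
      (∀ i ∈ s, r i ^ 2 = algebraMap M N (a i)) →
      (∀ T ⊆ s, T.Nonempty → ¬ IsSquare (∏ i ∈ T, a i)) →
      2 ^ s.card ≤ Module.finrank M N := by
  classical
  induction s using Finset.induction_on with
  | empty =>
    intro M _ _ _ _ a _ _
    exact Module.finrank_pos (R := M) (M := N)
  | insert i s his ih =>
    intro M _ _ _ _ a hr hT
    have hri := hr i (Finset.mem_insert_self i s)
    have hai : ¬ IsSquare (a i) := by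
      simpa using hT {i} (by simp) (by simp)
    have hIntegral : IsIntegral M (r i) := IsIntegral.of_finite M (r i)
    have hmin : minpoly M (r i) = X ^ 2 - C (a i) := by
      symm
      apply minpoly.eq_of_irreducible_of_monic
      · rw [X_pow_sub_C_irreducible_iff_of_prime Nat.prime_two]
        exact fun b hb => hai ⟨b, by rw [← hb, sq]⟩
      · simp [hri]
      · exact monic_X_pow_sub_C _ (by norm_num)
    have hrank : Module.finrank M M⟮r i⟯ = 2 := by
      rw [adjoin.finrank hIntegral, hmin, natDegree_X_pow_sub_C]
    have hmul : Module.finrank M M⟮r i⟯ * Module.finrank M⟮r i⟯ N = Module.finrank M N :=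
      Module.finrank_mul_finrank M M⟮r i⟯ N
    have : CharZero M⟮r i⟯ := charZero_of_injective_algebraMap (algebraMap M M⟮r i⟯).injective
    have hstep := ih M⟮r i⟯ (fun l => algebraMap M M⟮r i⟯ (a l))
      (fun l hl => by
        rw [hr l (Finset.mem_insert_of_mem hl)]
        exact IsScalarTower.algebraMap_apply M M⟮r i⟯ N _) (by
        rintro T hTs hTne ⟨z, hz⟩
        rw [← map_prod] at hz
        set A := ∏ l ∈ T, a l with hA
        have hiT : i ∉ T := fun hi => his (hTs hi)
        have hAsq : ¬ IsSquare A := hT T (hTs.trans (Finset.subset_insert i s)) hTne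
        have hAisq : ¬ IsSquare (a i * A) := by
          have := hT (insert i T) (Finset.insert_subset_insert i hTs) (Finset.insert_nonempty i T)
          rwa [Finset.prod_insert hiT] at this
        obtain ⟨f, hf⟩ : ∃ f : M[X], aeval (r i) f = (z : N) := by
          have hz2 : (z : N) ∈ Algebra.adjoin M {r i} := by
            rw [← adjoin_simple_toSubalgebra_of_isAlgebraic hIntegral.isAlgebraic]
            exact z.2
          rw [Algebra.adjoin_singleton_eq_range_aeval] at hz2
          exact hz2
        obtain ⟨p, q, hpq⟩ : ∃ p q : M, (z : N) = algebraMap M N p + algebraMap M N q * r i := by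
          have hmon : (X ^ 2 - C (a i)).Monic := monic_X_pow_sub_C _ (by norm_num)
          have hdeg : (f %ₘ (X ^ 2 - C (a i))).degree < 2 := by
            refine (degree_modByMonic_lt f hmon).trans_eq ?_
            exact degree_X_pow_sub_C (by norm_num) _
          have hle : (f %ₘ (X ^ 2 - C (a i))).degree ≤ 1 := Order.le_of_lt_succ hdeg
          refine ⟨(f %ₘ (X ^ 2 - C (a i))).coeff 0, (f %ₘ (X ^ 2 - C (a i))).coeff 1, ?_⟩
          rw [← hf, ← aeval_modByMonic_eq_self_of_root (q := X ^ 2 - C (a i)) (by simp [hri])]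
          conv_lhs => rw [eq_X_add_C_of_degree_le_one hle]
          simp
          ring
        have hzN : algebraMap M N A = (z : N) * z := by
          have := congrArg (algebraMap M⟮r i⟯ N) hz
          rw [← IsScalarTower.algebraMap_apply] at this
          simpa using this
        have hlin : algebraMap M N (A - p ^ 2 - q ^ 2 * a i) = algebraMap M N (2 * p * q) * r i := by
          simp only [map_sub, map_mul, map_pow, map_ofNat]
          rw [hzN, hpq]
          linear_combination (algebraMap M N q) ^ 2 * hri
        by_cases hpq0 : 2 * p * q = 0
        · rw [hpq0, map_zero, zero_mul, map_eq_zero] at hlin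
          rcases mul_eq_zero.mp hpq0 with h0 | h0
          · have hp : p = 0 := by simpa using h0
            subst hp
            apply hAisq
            exact ⟨a i * q, by linear_combination a i * hlin⟩
          · subst h0
            exact hAsq ⟨p, by linear_combination hlin⟩
        · apply hai
          refine ⟨(A - p ^ 2 - q ^ 2 * a i) / (2 * p * q), ?_⟩
          apply (algebraMap M N).injective
          rw [← hri, map_mul, map_div₀, hlin]
          have : algebraMap M N (2 * p * q) ≠ 0 := by simpa using hpq0
          field_simp)
    rw [Finset.card_insert_of_notMem his, pow_succ, ← hmul, hrank, mul_comm]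
    exact Nat.mul_le_mul_left 2 hstep

end Multiquadratic

section Tower

universe u

variable {K : Type u} [Field K] {γ c : K} {m : ℕ}

theorem two_pow_le_finrank_splittingField (hirr : Irreducible (quadIter γ c m)) :
    2 ^ m ≤ Module.finrank K (quadIter γ c m).SplittingField := by
  obtain ⟨x, hx⟩ := (SplittingField.splits (quadIter γ c m)).exists_eval_eq_zero (by
    rw [degree_map]
    exact (degree_pos_of_irreducible hirr).ne')
  have h := minpoly.natDegree_le (A := K) x
  rwa [← minpoly.eq_of_irreducible_of_monic hirr (by rwa [aeval_def, ← eval_map])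
    (monic_quadIter γ c m), natDegree_quadIter] at h

/-- A prime at which the critical orbit first vanishes at the index `m + 1`, to odd order, makes
the products of the differences `α - c` over roots `α` of the `m`-th iterate nonsquares. -/
theorem not_isSquare_prod_root_sub (hirr : Irreducible (quadIter γ c m))
    {L : Type*} [Field L] [IsAlgClosed L] [CharZero L]
    (j : K →+* FractionRing (PowerSeries L)) {g κ : PowerSeries L}
    (hg : j γ = algebraMap _ _ g) (hκ : j c = algebraMap _ _ κ)
    (h : ∀ i, 1 ≤ i → i ≤ m → PowerSeries.constantCoeff ((quad g κ)^[i] g) ≠ 0) {N : ℕ}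
    (hN : Odd N) (hord : ((quad g κ)^[m + 1] g).order = N)
    {M : Type*} [Field M] [Algebra K M] [(quadIter γ c m).IsSplittingField K M] {T : Finset M}
    (hT : ∀ α ∈ T, aeval α (quadIter γ c m) = 0) (hne : T.Nonempty) :
    ¬ IsSquare (∏ α ∈ T, (α - algebraMap K M c)) := by
  classical
  rintro ⟨z, hz⟩
  let F := FractionRing (PowerSeries L)
  let : Algebra K F := j.toAlgebra
  obtain ⟨s, hs⟩ := exists_quadIter_eq_prod h
  have hmap : (quadIter γ c m).map (algebraMap K F)
      = (s.map fun α => X - C (algebraMap (PowerSeries L) F α)).prod := by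
    rw [quadIter_map]
    have h1 : algebraMap K F γ = algebraMap (PowerSeries L) F g := hg
    have h2 : algebraMap K F c = algebraMap (PowerSeries L) F κ := hκ
    rw [h1, h2, ← quadIter_map, hs, Polynomial.map_multiset_prod, Multiset.map_map]
    simp
  have hsplits : ((quadIter γ c m).map (algebraMap K F)).Splits := by
    rw [hmap]
    refine Splits.multisetProd fun f hf => ?_
    obtain ⟨α, -, rfl⟩ := Multiset.mem_map.mp hf
    exact Splits.X_sub_C _
  let σ : M →ₐ[K] F := IsSplittingField.lift M _ hsplits
  have hσc : σ (algebraMap K M c) = algebraMap (PowerSeries L) F κ := by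
    rw [AlgHom.commutes]
    exact hκ
  have hσγ : σ (algebraMap K M γ) = algebraMap (PowerSeries L) F g := by
    rw [AlgHom.commutes]
    exact hg
  have hinj : Function.Injective (algebraMap (PowerSeries L) F) := IsFractionRing.injective _ _
  have hlift : ∀ α : M, aeval α (quadIter γ c m) = 0 →
      ∃ y, (quad g κ)^[m] y = 0 ∧ σ α = algebraMap (PowerSeries L) F y := by
    intro α hα
    have h1 : ((quadIter γ c m).map (algebraMap K F)).eval (σ α) = 0 := by
      rw [eval_map, ← aeval_def, aeval_algHom_apply, hα, map_zero]
    rw [hmap, eval_multiset_prod, Multiset.map_map, Multiset.prod_eq_zero_iff,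
      Multiset.mem_map] at h1
    obtain ⟨y, -, hy⟩ := h1
    have hy' : σ α = algebraMap (PowerSeries L) F y := by
      simpa [sub_eq_zero] using hy
    refine ⟨y, ?_, hy'⟩
    apply hinj
    rw [map_quad_iterate, ← hy', ← hσc, ← hσγ, map_zero, ← AlgHom.coe_toRingHom,
      ← map_quad_iterate, ← aeval_quadIter, hα, map_zero]
  obtain ⟨x, hx, ⟨N', hN', hxN⟩, hother⟩ := exists_root_odd_order h hN hord
  obtain ⟨α₀, hα₀⟩ : ∃ α₀ : M, σ α₀ = algebraMap (PowerSeries L) F x := by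
    refine Splits.mem_range_of_isRoot (f := (quadIter γ c m).map (algebraMap K M))
      (i := σ.toRingHom) (IsSplittingField.splits M _)
      ((monic_quadIter γ c m).map (algebraMap K M)).ne_zero ?_
    · rw [Polynomial.map_map, IsRoot.def, quadIter_map, eval_quadIter]
      have h1 : (σ.toRingHom.comp (algebraMap K M)) γ = algebraMap (PowerSeries L) F g := hσγ
      have h2 : (σ.toRingHom.comp (algebraMap K M)) c = algebraMap (PowerSeries L) F κ := hσc
      rw [h1, h2, ← map_quad_iterate, hx, map_zero]
  have hα₀root : aeval α₀ (quadIter γ c m) = 0 := by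
    apply σ.toRingHom.injective
    rw [aeval_quadIter, map_quad_iterate, map_zero]
    change (quad (σ _) (σ _))^[m] (σ _) = 0
    rw [hσγ, hσc, hα₀, ← map_quad_iterate, hx, map_zero]
  obtain ⟨α₁, hα₁⟩ := hne
  have hmin : quadIter γ c m = minpoly K α₁ :=
    minpoly.eq_of_irreducible_of_monic hirr (hT α₁ hα₁) (monic_quadIter γ c m)
  have : Normal K M := Normal.of_isSplittingField (quadIter γ c m)
  have : FiniteDimensional K M := IsSplittingField.finiteDimensional M (quadIter γ c m)
  obtain ⟨θ, hθ⟩ := minpoly.exists_algEquiv_of_root' (K := K) (x := α₀) (y := α₁)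
    (Algebra.IsAlgebraic.isAlgebraic α₁) (by rw [← hmin, hα₀root])
  have hθroot : ∀ α ∈ T, ∃ y, (quad g κ)^[m] y = 0 ∧
      σ (θ α) = algebraMap (PowerSeries L) F y := fun α hα => hlift _ (by
    rw [aeval_algHom_apply, hT α hα, map_zero])
  choose! ρ hρ hσρ using hθroot
  have hρ₁ : ρ α₁ = x := hinj (by rw [← hσρ α₁ hα₁, hθ, hα₀])
  have hprod : IsSquare (algebraMap (PowerSeries L) F (∏ α ∈ T, (ρ α - κ))) := by
    refine ⟨σ (θ z), ?_⟩
    rw [← map_mul, ← map_mul, ← hz, map_prod, map_prod, map_prod]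
    refine Finset.prod_congr rfl fun α hα => ?_
    rw [map_sub, map_sub, map_sub, AlgEquiv.commutes, hσc, hσρ α hα]
  refine not_isSquare_of_odd_order hN' ?_ hprod
  rw [← Finset.mul_prod_erase T _ hα₁, PowerSeries.order_mul, hρ₁, ← neg_sub, PowerSeries.order_neg,
    hxN]
  have hrest : (∏ α ∈ T.erase α₁, (ρ α - κ)).order = 0 := by
    by_contra hne
    have h0 := PowerSeries.order_ne_zero_iff_constCoeff_eq_zero.mp hne
    rw [map_prod, Finset.prod_eq_zero_iff] at h0
    obtain ⟨α, hα, h0⟩ := h0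
    obtain ⟨hαne, hαT⟩ := Finset.mem_erase.mp hα
    refine hother (ρ α) (hρ α hαT) (fun heq => hαne ?_) (by rw [← neg_sub, map_neg, h0, neg_zero])
    apply θ.injective
    apply σ.toRingHom.injective
    change σ (θ α) = σ (θ α₁)
    rw [hσρ α hαT, hσρ α₁ hα₁, heq, hρ₁]
  rw [hrest, add_zero]

theorem two_pow_le_finrank_of_isSplittingField [CharZero K] (hirr : Irreducible (quadIter γ c m))
    {L : Type*} [Field L] [IsAlgClosed L] [CharZero L]
    (j : K →+* FractionRing (PowerSeries L)) {g κ : PowerSeries L}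
    (hg : j γ = algebraMap _ _ g) (hκ : j c = algebraMap _ _ κ)
    (h : ∀ i, 1 ≤ i → i ≤ m → PowerSeries.constantCoeff ((quad g κ)^[i] g) ≠ 0) {N : ℕ}
    (hN : Odd N) (hord : ((quad g κ)^[m + 1] g).order = N)
    {M E : Type u} [Field M] [Algebra K M] [(quadIter γ c m).IsSplittingField K M]
    [Field E] [Algebra K E] [(quadIter γ c (m + 1)).IsSplittingField K E]
    [Algebra M E] [IsScalarTower K M E] :
    2 ^ 2 ^ m ≤ Module.finrank M E := by
  classical
  have : FiniteDimensional K E := IsSplittingField.finiteDimensional E (quadIter γ c (m + 1))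
  have : FiniteDimensional M E := FiniteDimensional.right K M E
  have : CharZero M := charZero_of_injective_algebraMap (algebraMap K M).injective
  set Z : Finset M := ((quadIter γ c m).rootSet M).toFinset with hZ
  have hZroot : ∀ α ∈ Z, aeval α (quadIter γ c m) = 0 := fun α hα =>
    aeval_eq_zero_of_mem_rootSet (Set.mem_toFinset.mp hα)
  have hZcard : Z.card = 2 ^ m := by
    rw [hZ, Set.toFinset_card, card_rootSet_eq_natDegree hirr.separable (IsSplittingField.splits M _),
      natDegree_quadIter]
  rw [← hZcard]
  have hsqrt : ∀ α ∈ Z, ∃ r : E, r ^ 2 = algebraMap M E (α - algebraMap K M c) := by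
    intro α hα
    set f : E[X] := (X - C (algebraMap K E γ)) ^ 2 + C (algebraMap K E c - algebraMap M E α) with hf
    have hdvd : f ∣ (quadIter γ c (m + 1)).map (algebraMap K E) := by
      have h1 : X - C (algebraMap M E α) ∣ (quadIter γ c m).map (algebraMap K E) := by
        rw [dvd_iff_isRoot, IsRoot.def, eval_map, ← aeval_def, aeval_algebraMap_apply,
          hZroot α hα, map_zero]
      obtain ⟨p, hp⟩ := h1
      refine ⟨p.comp ((X - C (algebraMap K E γ)) ^ 2 + C (algebraMap K E c)), ?_⟩
      rw [quadIter_succ, Polynomial.map_comp, hp, mul_comp]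
      simp only [Polynomial.map_add, Polynomial.map_pow, Polynomial.map_sub, map_X, map_C,
        sub_comp, X_comp, C_comp, hf, map_sub]
      ring
    obtain ⟨β, hβ⟩ := ((IsSplittingField.splits E (quadIter γ c (m + 1))).of_dvd
      ((monic_quadIter γ c (m + 1)).map _).ne_zero hdvd).exists_eval_eq_zero (by
        rw [degree_eq_natDegree (monic_X_sub_C_sq_add_C _ _).ne_zero, natDegree_X_sub_C_sq_add_C]
        norm_num)
    refine ⟨β - algebraMap K E γ, ?_⟩
    simp only [hf, eval_add, eval_pow, eval_sub, eval_X, eval_C] at hβ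
    rw [map_sub, ← IsScalarTower.algebraMap_apply]
    linear_combination hβ
  choose! r hr using hsqrt
  refine two_pow_card_le_finrank Z r M (fun α => α - algebraMap K M c) hr ?_
  intro T hTZ hTne
  exact not_isSquare_prod_root_sub hirr j hg hκ h hN hord (fun α hα => hZroot α (hTZ hα)) hTne

theorem finrank_mul_two_pow_le [CharZero K] (hirr : Irreducible (quadIter γ c m))
    {L : Type*} [Field L] [IsAlgClosed L] [CharZero L]
    (j : K →+* FractionRing (PowerSeries L)) {g κ : PowerSeries L}
    (hg : j γ = algebraMap _ _ g) (hκ : j c = algebraMap _ _ κ)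
    (h : ∀ i, 1 ≤ i → i ≤ m → PowerSeries.constantCoeff ((quad g κ)^[i] g) ≠ 0) {N : ℕ}
    (hN : Odd N) (hord : ((quad g κ)^[m + 1] g).order = N) :
    Module.finrank K (quadIter γ c m).SplittingField * 2 ^ 2 ^ m
      ≤ Module.finrank K (quadIter γ c (m + 1)).SplittingField := by
  have hsplits := Gal.splits_in_splittingField_of_comp (quadIter γ c m) ((X - C γ) ^ 2 + C c)
    (by rw [natDegree_X_sub_C_sq_add_C]; norm_num)
  rw [← quadIter_succ] at hsplits
  let f := SplittingField.lift _ hsplits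
  let : Algebra (quadIter γ c m).SplittingField (quadIter γ c (m + 1)).SplittingField :=
    f.toRingHom.toAlgebra
  have : IsScalarTower K (quadIter γ c m).SplittingField (quadIter γ c (m + 1)).SplittingField :=
    IsScalarTower.of_algebraMap_eq fun x => (f.commutes x).symm
  rw [← Module.finrank_mul_finrank K (quadIter γ c m).SplittingField
    (quadIter γ c (m + 1)).SplittingField]
  exact Nat.mul_le_mul_left _ (two_pow_le_finrank_of_isSplittingField hirr j hg hκ h hN hord)

end Tower

section Expansion

variable {k : Type*} [Field k] {L : Type*} [Field L] [Algebra k L]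

/-- The expansion of a polynomial as a power series at `τ`. -/
noncomputable def expandAt (τ : L) : k[X] →+* PowerSeries L :=
  (coeToPowerSeries.ringHom (R := L)).comp
    ((taylorAlgHom τ).toRingHom.comp (mapRingHom (algebraMap k L)))

theorem expandAt_apply (τ : L) (p : k[X]) :
    expandAt τ p = ((taylor τ (p.map (algebraMap k L)) : L[X]) : PowerSeries L) := rfl

theorem expandAt_injective (τ : L) : Function.Injective (expandAt (k := k) τ) := by
  intro p q h
  rw [expandAt_apply, expandAt_apply, coe_inj, taylor_inj] at h
  exact map_injective _ (algebraMap k L).injective h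

theorem constantCoeff_expandAt (τ : L) (p : k[X]) :
    PowerSeries.constantCoeff (expandAt τ p) = aeval τ p := by
  rw [expandAt_apply, ← PowerSeries.coeff_zero_eq_constantCoeff_apply, coeff_coe,
    taylor_coeff_zero, eval_map, aeval_def]

theorem order_expandAt_of_separable {τ : L} {e : k[X]} (he : e.Separable) (hτ : aeval τ e = 0) :
    (expandAt τ e).order = 1 := by
  have h : (expandAt τ e).order = (1 : ℕ) := by
    rw [PowerSeries.order_eq_nat]
    constructor
    · rw [expandAt_apply, coeff_coe, taylor_coeff_one, derivative_map, eval_map, ← aeval_def]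
      exact he.aeval_derivative_ne_zero hτ
    · intro i hi
      obtain rfl : i = 0 := by omega
      rw [PowerSeries.coeff_zero_eq_constantCoeff_apply, constantCoeff_expandAt, hτ]
  exact_mod_cast h

end Expansion

section Main

variable {k : Type*} [Field k] {γ c : k[X]}

theorem quad_iterate_ne_zero_of_irreducible {n : ℕ} (hn : 1 ≤ n)
    (hirr : Irreducible
      (quadIter (algebraMap k[X] (RatFunc k) γ) (algebraMap k[X] (RatFunc k) c) n)) (x : k[X]) :
    (quad γ c)^[n] x ≠ 0 := by
  intro h0
  have h1 := degree_eq_one_of_irreducible_of_root hirr (x := algebraMap k[X] (RatFunc k) x) (by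
    rw [IsRoot.def, eval_quadIter, ← map_quad_iterate, h0, map_zero])
  have h2 : (quadIter (algebraMap k[X] (RatFunc k) γ)
      (algebraMap k[X] (RatFunc k) c) n).natDegree = 1 := natDegree_eq_of_degree_eq_some h1
  rw [natDegree_quadIter] at h2
  have : 2 ^ 1 ≤ 2 ^ n := Nat.pow_le_pow_right (by norm_num) hn
  omega

/-- From level `17` on, every step of the tower of splitting fields is as large as possible. -/
theorem finrank_splittingField_mul_two_pow_le [CharZero k] (hdeg : γ.natDegree ≠ c.natDegree)
    (hirr : ∀ n, 1 ≤ n → Irreducible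
      (quadIter (algebraMap k[X] (RatFunc k) γ) (algebraMap k[X] (RatFunc k) c) n))
    {n : ℕ} (hn : 16 ≤ n) :
    Module.finrank (RatFunc k) (quadIter (algebraMap k[X] (RatFunc k) γ)
        (algebraMap k[X] (RatFunc k) c) n).SplittingField * 2 ^ 2 ^ n
      ≤ Module.finrank (RatFunc k) (quadIter (algebraMap k[X] (RatFunc k) γ)
        (algebraMap k[X] (RatFunc k) c) (n + 1)).SplittingField := by
  have hne : ∀ x : k[X], ∀ n, 1 ≤ n → (quad γ c)^[n] x ≠ 0 := fun x n hn =>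
    quad_iterate_ne_zero_of_irreducible hn (hirr n hn) x
  have hc : c ≠ 0 := by simpa [quad_self] using hne γ 1 le_rfl
  obtain ⟨τ, e, y, hey, hsep, hτ, hprim⟩ :=
    exists_primitive_zero hdeg hc (hne γ) (hne 0) (n := n + 1) (by omega)
  have hinj : Function.Injective ((algebraMap (PowerSeries (AlgebraicClosure k))
      (FractionRing (PowerSeries (AlgebraicClosure k)))).comp (expandAt (k := k) τ)) :=
    (IsFractionRing.injective _ _).comp (expandAt_injective τ)
  have hy : expandAt τ y ≠ 0 := by
    rw [Ne, map_eq_zero_iff _ (expandAt_injective τ)]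
    rintro rfl
    exact hne γ (n + 1) (by omega) (by simp [hey])
  have : CharZero (RatFunc k) :=
    charZero_of_injective_algebraMap (algebraMap k (RatFunc k)).injective
  refine finrank_mul_two_pow_le (hirr n (by omega)) (L := AlgebraicClosure k)
    (IsFractionRing.lift hinj) (g := expandAt τ γ) (κ := expandAt τ c)
    (IsFractionRing.lift_algebraMap hinj γ) (IsFractionRing.lift_algebraMap hinj c) ?_
    (N := 1 + 2 * (expandAt τ y).order.toNat) (by simp [parity_simps]) ?_
  · intro i h1 h2
    rw [← map_quad_iterate, constantCoeff_expandAt]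
    exact hprim i h1 (by omega)
  · rw [← map_quad_iterate, hey, map_mul, map_pow, PowerSeries.order_mul, PowerSeries.order_pow,
      order_expandAt_of_separable hsep hτ]
    push_cast
    rw [PowerSeries.coe_toNat_order hy]
    simp

theorem two_pow_le_mul_of_step {a : ℕ → ℕ} {B : ℕ} (hB : 2 ^ (2 ^ B - 1) ≤ a B)
    (hstep : ∀ n, B ≤ n → a n * 2 ^ 2 ^ n ≤ a (n + 1)) {n : ℕ} (hn : B ≤ n) :
    2 ^ (2 ^ n - 1) ≤ a n := by
  induction n, hn using Nat.le_induction with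
  | base => exact hB
  | succ n hn ih =>
    refine le_trans ?_ (hstep n hn)
    have h1 : 2 ^ (n + 1) - 1 = (2 ^ n - 1) + 2 ^ n := by
      have : 1 ≤ 2 ^ n := Nat.one_le_two_pow
      rw [pow_succ]
      omega
    rw [h1, pow_add]
    exact Nat.mul_le_mul_right _ ih

end Main

/-- Theorem 1 part 1 (uniform index bound): if `φ = (x-γ)²+c` over `K = k(t)` is stable,
post-critically infinite and `h(γ) ≠ h(c)`, then for all `n ≥ 1`,
`2^(2^n - 1) ≤ 2^65519 · [K_n : K]`, i.e. `log₂|Aut(T_n) : G_n(φ)| ≤ 2^16 - 17`. -/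
theorem uniform_index_bound (k : Type*) [Field k] [CharZero k] (γ c : Polynomial k)
    (φ : Polynomial (RatFunc k))
    (hφ : φ = (X - C (algebraMap (Polynomial k) (RatFunc k) γ)) ^ 2
            + C (algebraMap (Polynomial k) (RatFunc k) c))
    (hstable : ∀ n : ℕ, 1 ≤ n →
      Irreducible ((fun p => p.comp φ)^[n] (X : Polynomial (RatFunc k))))
    (hpci : Set.Infinite
      {x : Polynomial k | ∃ n : ℕ, 1 ≤ n ∧ (fun a => (a - γ) ^ 2 + c)^[n] γ = x})
    (hdeg : γ.natDegree ≠ c.natDegree) :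
    ∀ n : ℕ, 1 ≤ n →
      2 ^ (2 ^ n - 1) ≤ 2 ^ 65519 * Module.finrank (RatFunc k)
        (Polynomial.SplittingField ((fun p => p.comp φ)^[n] (X : Polynomial (RatFunc k)))) := by
  subst hφ
  have hfin : ∀ n, 1 ≤ n → 2 ^ n ≤ Module.finrank (RatFunc k)
      (quadIter (algebraMap k[X] (RatFunc k) γ) (algebraMap k[X] (RatFunc k) c) n).SplittingField :=
    fun n hn => two_pow_le_finrank_splittingField (hstable n hn)
  intro n hn
  change 2 ^ (2 ^ n - 1) ≤ 2 ^ 65519 * Module.finrank (RatFunc k)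
    (quadIter (algebraMap k[X] (RatFunc k) γ) (algebraMap k[X] (RatFunc k) c) n).SplittingField
  generalize hE : 65519 = E
  by_cases h16 : 16 ≤ n
  · refine two_pow_le_mul_of_step (a := fun n => 2 ^ E * Module.finrank (RatFunc k) (quadIter
      (algebraMap k[X] (RatFunc k) γ) (algebraMap k[X] (RatFunc k) c) n).SplittingField)
      ?_ (fun i hi => ?_) h16
    · have hexp : 2 ^ 16 - 1 = E + 16 := by
        rw [← hE]
        norm_num
      rw [hexp, pow_add]
      exact Nat.mul_le_mul_left _ (hfin 16 (by norm_num))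
    · rw [mul_assoc]
      exact Nat.mul_le_mul_left _ (finrank_splittingField_mul_two_pow_le hdeg hstable hi)
  · have hpow : 2 ^ n ≤ 2 ^ 15 := Nat.pow_le_pow_right (by norm_num) (by omega)
    have hexp : 2 ^ n - 1 ≤ E := by
      rw [← hE]
      norm_num at hpow
      omega
    refine (Nat.pow_le_pow_right (by norm_num) hexp).trans (Nat.le_mul_of_pos_right _ ?_)
    exact lt_of_lt_of_le (by positivity) (hfin n hn)
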